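/- Let X be a continuous L-space with spatial part Y and let U be a clopen upset of X. The following are equivalent: (1) ker U = core U; (2) core U is dense in U; (3) for each y ∈ U ∩ Y there is V ∈ ClopSUp(X) such that y ∈ V ⊆ U; (4) for each Scott upset F with F ⊆ ker U there is V ∈ ClopSUp(X) such that F ⊆ V ⊆ U. -/

import Mathlib

open Set Topology

/-- Clopen upsets of a topological space with a partial order. -/
def ClopUp (X : Type*) [TopologicalSpace X] [Preorder X] : Set (Set X) :=
  {U | IsClopen U ∧ IsUpperSet U}

/-- Downward closure of a set. -/
def downClosure (X : Type*) [Preorder X] (A : Set X) : Set X := {x | ∃ y ∈ A, x ≤ y}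

/-- Priestley space: compact, and clopen upsets separate points via the Priestley separation axiom. -/
def IsPriestley (X : Type*) [TopologicalSpace X] [Preorder X] : Prop :=
  CompactSpace X ∧ ∀ x y : X, ¬x ≤ y → ∃ U ∈ ClopUp X, x ∈ U ∧ y ∉ U

/-- Esakia space: a Priestley space in which downward closures of clopens are clopen. -/
def IsEsakia (X : Type*) [TopologicalSpace X] [Preorder X] : Prop :=
  IsPriestley X ∧ ∀ U : Set X, IsClopen U → IsClopen (downClosure X U)

/-- L-space: an extremally order-disconnected Esakia space. -/
def IsLSpace (X : Type*) [TopologicalSpace X] [Preorder X] : Prop :=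
  IsEsakia X ∧ ∀ U : Set X, IsOpen U → IsUpperSet U → IsOpen (closure U)

/-- The spatial part of an L-space: points with clopen downset. -/
def spatialPart (X : Type*) [TopologicalSpace X] [Preorder X] : Set X :=
  {y : X | IsClopen {x : X | x ≤ y}}

/-- Scott upset: a closed upset all of whose minimal points lie in the spatial part. -/
def IsScottUpset (X : Type*) [TopologicalSpace X] [Preorder X] (F : Set X) : Prop :=
  IsClosed F ∧ IsUpperSet F ∧ ∀ y ∈ F, (∀ z ∈ F, z ≤ y → z = y) → y ∈ spatialPart X

/-- Clopen Scott upsets. -/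
def ClopSUp (X : Type*) [TopologicalSpace X] [Preorder X] : Set (Set X) :=
  {U | IsClopen U ∧ IsScottUpset X U}

/-- Clopen bisets (both upsets and downsets). -/
def ClopBi (X : Type*) [TopologicalSpace X] [Preorder X] : Set (Set X) :=
  {U | IsClopen U ∧ IsUpperSet U ∧ IsLowerSet U}

/-- `V ≪ U` for clopen upsets: every open upset whose closure contains `U` contains `V`. -/
def wayBelowSet (X : Type*) [TopologicalSpace X] [Preorder X] (V U : Set X) : Prop :=
  ∀ W : Set X, IsOpen W → IsUpperSet W → U ⊆ closure W → V ⊆ W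

/-- The kernel of a clopen upset. -/
def kerSet (X : Type*) [TopologicalSpace X] [Preorder X] (U : Set X) : Set X :=
  ⋃₀ {V | V ∈ ClopUp X ∧ wayBelowSet X V U}

/-- The core of a clopen upset. -/
def coreSet (X : Type*) [TopologicalSpace X] [Preorder X] (U : Set X) : Set X :=
  ⋃₀ {V | V ∈ ClopSUp X ∧ V ⊆ U}

/-- The regular part of a clopen upset. -/
def regSet (X : Type*) [TopologicalSpace X] [Preorder X] (U : Set X) : Set X :=
  ⋃₀ {V | V ∈ ClopUp X ∧ downClosure X V ⊆ U}

/-- The center of a clopen upset. -/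
def cenSet (X : Type*) [TopologicalSpace X] [Preorder X] (U : Set X) : Set X :=
  ⋃₀ {V | V ∈ ClopBi X ∧ V ⊆ U}

/-- The topology on the spatial part, generated by traces of clopen upsets. -/
def spatialTop (X : Type*) [TopologicalSpace X] [Preorder X] :
    TopologicalSpace (spatialPart X) :=
  TopologicalSpace.generateFrom
    {V : Set (spatialPart X) | ∃ U ∈ ClopUp X, V = ((↑) : spatialPart X → X) ⁻¹' U}

/-- An algebraic L-space: the core of every clopen upset is dense in it. -/
def IsAlgebraicLSpace (X : Type*) [TopologicalSpace X] [Preorder X] : Prop :=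
  IsLSpace X ∧ ∀ U ∈ ClopUp X, U ⊆ closure (coreSet X U)

/-- A space is compactly based if compact open sets form a basis. -/
def CompactlyBased (Y : Type*) [TopologicalSpace Y] : Prop :=
  ∀ V : Set Y, IsOpen V → ∀ y ∈ V, ∃ K : Set Y, IsOpen K ∧ IsCompact K ∧ y ∈ K ∧ K ⊆ V

/-- A set is saturated if it is the intersection of the open sets containing it. -/
def IsSaturatedSet {Y : Type*} [TopologicalSpace Y] (K : Set Y) : Prop :=
  K = ⋂₀ {U : Set Y | IsOpen U ∧ K ⊆ U}

/-- The way-below relation in a frame. -/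
def frameWayBelow {L : Type*} [Order.Frame L] (a b : L) : Prop :=
  ∀ S : Set L, b ≤ sSup S → ∃ T : Set L, T ⊆ S ∧ T.Finite ∧ a ≤ sSup T

/-- A compact element of a frame. -/
def IsCompactElt {L : Type*} [Order.Frame L] (a : L) : Prop := frameWayBelow a a

/-- An algebraic frame: every element is the join of the compact elements below it. -/
def AlgebraicFrame (L : Type*) [Order.Frame L] : Prop :=
  ∀ a : L, a = sSup {k : L | IsCompactElt k ∧ k ≤ a}

/-- An arithmetic frame: algebraic with stable way-below relation. -/
def ArithmeticFrame (L : Type*) [Order.Frame L] : Prop :=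
  AlgebraicFrame L ∧
    ∀ a b c : L, frameWayBelow a b → frameWayBelow a c → frameWayBelow a (b ⊓ c)

/-- A coherent frame: arithmetic and compact. -/
def CoherentFrame (L : Type*) [Order.Frame L] : Prop :=
  ArithmeticFrame L ∧ IsCompactElt (⊤ : L)

/-- A prime filter of a frame. -/
def IsPrimeFilter {L : Type*} [Order.Frame L] (F : Set L) : Prop :=
  F.Nonempty ∧ F ≠ Set.univ ∧ (∀ a ∈ F, ∀ b : L, a ≤ b → b ∈ F) ∧
    (∀ a ∈ F, ∀ b ∈ F, a ⊓ b ∈ F) ∧ ∀ a b : L, a ⊔ b ∈ F → a ∈ F ∨ b ∈ F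

/-- A completely prime filter of a frame. -/
def IsCompletelyPrimeFilter {L : Type*} [Order.Frame L] (F : Set L) : Prop :=
  F.Nonempty ∧ F ≠ Set.univ ∧ (∀ a ∈ F, ∀ b : L, a ≤ b → b ∈ F) ∧
    (∀ a ∈ F, ∀ b ∈ F, a ⊓ b ∈ F) ∧ ∀ S : Set L, sSup S ∈ F → ∃ s ∈ S, s ∈ F

/-- The Priestley space of a frame: prime filters ordered by inclusion. -/
abbrev PriestleyDual (L : Type*) [Order.Frame L] : Type _ := {F : Set L // IsPrimeFilter F}

/-- The Priestley topology on the Priestley space of a frame. -/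
instance PriestleyDual.instTopologicalSpace (L : Type*) [Order.Frame L] :
    TopologicalSpace (PriestleyDual L) :=
  TopologicalSpace.generateFrom
    ({S : Set (PriestleyDual L) | ∃ a : L, S = {x | a ∈ x.val}} ∪
     {S : Set (PriestleyDual L) | ∃ a : L, S = {x | a ∈ x.val}ᶜ})

section LSpace

variable {X : Type*} [TopologicalSpace X]

section Preorder

variable [Preorder X]

theorem wayBelowSet.mono {K K' V V' : Set X} (h : wayBelowSet X K V) (hK : K' ⊆ K)
    (hV : V ⊆ V') : wayBelowSet X K' V' :=
  fun W hWo hWu hW => hK.trans (h W hWo hWu (hV.trans hW))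

theorem wayBelowSet.subset {K V : Set X} (h : wayBelowSet X K V) (hV : V ∈ ClopUp X) : K ⊆ V :=
  h V hV.1.isOpen hV.2 subset_closure

theorem wayBelowSet.union {K K' V : Set X} (h : wayBelowSet X K V) (h' : wayBelowSet X K' V) :
    wayBelowSet X (K ∪ K') V :=
  fun W hWo hWu hW => union_subset (h W hWo hWu hW) (h' W hWo hWu hW)

theorem wayBelowSet_empty (V : Set X) : wayBelowSet X ∅ V := fun _ _ _ _ => empty_subset _

theorem empty_mem_ClopUp : (∅ : Set X) ∈ ClopUp X := ⟨isClopen_empty, isUpperSet_empty⟩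

theorem union_mem_ClopUp {V V' : Set X} (hV : V ∈ ClopUp X) (hV' : V' ∈ ClopUp X) :
    V ∪ V' ∈ ClopUp X :=
  ⟨hV.1.union hV'.1, hV.2.union hV'.2⟩

theorem isUpperSet_coreSet (U : Set X) : IsUpperSet (coreSet X U) :=
  isUpperSet_sUnion fun _ hV => hV.1.2.2.1

theorem isOpen_kerSet (U : Set X) : IsOpen (kerSet X U) :=
  isOpen_sUnion fun _ hV => hV.1.1.isOpen

theorem isUpperSet_kerSet (U : Set X) : IsUpperSet (kerSet X U) :=
  isUpperSet_sUnion fun _ hV => hV.1.2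

theorem kerSet_subset {U : Set X} (hU : U ∈ ClopUp X) : kerSet X U ⊆ U :=
  sUnion_subset fun _ hV => hV.2.subset hU

/-- A point of the spatial part in the closure of an upper set lies in that upper set. -/
theorem mem_of_mem_closure_of_mem_spatialPart {W : Set X} (hW : IsUpperSet W) {y : X}
    (hy : y ∈ spatialPart X) (hyW : y ∈ closure W) : y ∈ W := by
  obtain ⟨z, hzy, hzW⟩ := mem_closure_iff.1 hyW _ hy.isOpen le_rfl
  exact hW hzy hzW

theorem IsPriestley.isClosed_Iic (hX : IsPriestley X) (y : X) : IsClosed (Iic y) := by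
  rw [← isOpen_compl_iff, isOpen_iff_forall_mem_open]
  intro x hx
  obtain ⟨V, hV, hxV, hyV⟩ := hX.2 x y hx
  exact ⟨V, fun z hz hzy => hyV (hV.2 hzy hz), hV.1.isOpen, hxV⟩

theorem empty_mem_ClopSUp : (∅ : Set X) ∈ ClopSUp X :=
  ⟨isClopen_empty, isClosed_empty, isUpperSet_empty, fun _ h => h.elim⟩

theorem union_mem_ClopSUp {V V' : Set X} (hV : V ∈ ClopSUp X) (hV' : V' ∈ ClopSUp X) :
    V ∪ V' ∈ ClopSUp X := by
  refine ⟨hV.1.union hV'.1, hV.2.1.union hV'.2.1, hV.2.2.1.union hV'.2.2.1, ?_⟩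
  rintro y (hy | hy) hmin
  · exact hV.2.2.2 y hy fun z hz => hmin z (Or.inl hz)
  · exact hV'.2.2.2 y hy fun z hz => hmin z (Or.inr hz)

/-- Interpolation for `≪` in a continuous L-space. -/
theorem wayBelowSet.exists_between [CompactSpace X]
    (hcont : ∀ U ∈ ClopUp X, U ⊆ closure (kerSet X U)) {V U : Set X}
    (hV : IsClosed V) (hU : U ∈ ClopUp X) (hVU : wayBelowSet X V U) :
    ∃ V' ∈ ClopUp X, wayBelowSet X V' U ∧ wayBelowSet X V V' := by
  have hcover : V ⊆ ⋃ V' ∈ {V' | V' ∈ ClopUp X ∧ wayBelowSet X V' U}, kerSet X V' := by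
    refine hVU _ (isOpen_biUnion fun _ _ => isOpen_kerSet _)
      (isUpperSet_iUnion₂ fun _ _ => isUpperSet_kerSet _) ?_
    refine (hcont U hU).trans (closure_minimal (sUnion_subset fun V' hV' => ?_) isClosed_closure)
    exact (hcont V' hV'.1).trans (closure_mono (subset_biUnion_of_mem (u := kerSet X) hV'))
  refine hV.isCompact.induction_on
    (p := fun K => ∃ V' ∈ ClopUp X, wayBelowSet X V' U ∧ wayBelowSet X K V') ?_ ?_ ?_ ?_
  · exact ⟨∅, empty_mem_ClopUp, wayBelowSet_empty _, wayBelowSet_empty _⟩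
  · rintro K K' hK ⟨V', hV', hVU', hKV'⟩
    exact ⟨V', hV', hVU', hKV'.mono hK Subset.rfl⟩
  · rintro K K' ⟨V₁, hV₁, hVU₁, hKV₁⟩ ⟨V₂, hV₂, hVU₂, hKV₂⟩
    exact ⟨V₁ ∪ V₂, union_mem_ClopUp hV₁ hV₂, hVU₁.union hVU₂,
      (hKV₁.mono Subset.rfl subset_union_left).union (hKV₂.mono Subset.rfl subset_union_right)⟩
  · intro x hx
    obtain ⟨V', ⟨hV', hVU'⟩, K, ⟨hK, hKV'⟩, hxK⟩ := mem_iUnion₂.1 (hcover hx)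
    exact ⟨K, mem_nhdsWithin_of_mem_nhds (hK.1.isOpen.mem_nhds hxK), V', hV', hVU', hKV'⟩

end Preorder

variable [PartialOrder X]

/-- In a Priestley space every point of a closed set lies above a minimal point of that set. -/
theorem IsPriestley.exists_minimal_le (hX : IsPriestley X) {F : Set X} (hF : IsClosed F)
    {x : X} (hx : x ∈ F) : ∃ y ∈ F, y ≤ x ∧ ∀ z ∈ F, z ≤ y → z = y := by
  have := hX.1
  obtain ⟨y, hyx, hy⟩ := zorn_le_nonempty₀ (α := Xᵒᵈ) (OrderDual.ofDual ⁻¹' F)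
    (fun c hcF hc a ha => by
      have hne : (⋂ z : c, (F ∩ Iic (OrderDual.ofDual z.1))).Nonempty := by
        have : Nonempty c := ⟨⟨a, ha⟩⟩
        refine IsCompact.nonempty_iInter_of_directed_nonempty_isCompact_isClosed _ ?_
          (fun z => ⟨_, hcF z.2, le_rfl⟩)
          (fun z => (hF.inter (hX.isClosed_Iic _)).isCompact)
          (fun z => hF.inter (hX.isClosed_Iic _))
        rintro z w
        rcases hc.total z.2 w.2 with h | h
        · exact ⟨w, inter_subset_inter_right _ (Iic_subset_Iic.2 h), Subset.rfl⟩
        · exact ⟨z, Subset.rfl, inter_subset_inter_right _ (Iic_subset_Iic.2 h)⟩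
      obtain ⟨l, hl⟩ := hne
      rw [mem_iInter] at hl
      exact ⟨OrderDual.toDual l, (hl ⟨a, ha⟩).1, fun z hz => (hl ⟨z, hz⟩).2⟩)
    (OrderDual.toDual x) hx
  exact ⟨OrderDual.ofDual y, hy.1, hyx, fun z hz hzy => le_antisymm hzy (hy.2 hz hzy)⟩

theorem ClopSUp.wayBelowSet_self (hX : IsPriestley X) {V : Set X} (hV : V ∈ ClopSUp X) :
    wayBelowSet X V V := by
  intro W _ hWu hVW x hx
  obtain ⟨y, hy, hyx, hmin⟩ := hX.exists_minimal_le hV.2.1 hx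
  exact hWu hyx (mem_of_mem_closure_of_mem_spatialPart hWu (hV.2.2.2 y hy hmin) (hVW hy))

theorem coreSet_subset_kerSet (hX : IsPriestley X) (U : Set X) : coreSet X U ⊆ kerSet X U :=
  sUnion_subset fun _ hV => subset_sUnion_of_mem
    ⟨⟨hV.1.1, hV.1.2.2.1⟩, (ClopSUp.wayBelowSet_self hX hV.1).mono Subset.rfl hV.2⟩

/-- The intersection of a `≪`-descending sequence of clopen upsets is a Scott upset. -/
theorem IsLSpace.isScottUpset_iInter (hX : IsLSpace X) {V : ℕ → Set X}
    (hV : ∀ n, V n ∈ ClopUp X) (hVs : ∀ n, wayBelowSet X (V (n + 1)) (V n)) :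
    IsScottUpset X (⋂ n, V n) := by
  have := hX.1.1.1
  refine ⟨isClosed_iInter fun n => (hV n).1.isClosed, isUpperSet_iInter fun n => (hV n).2, ?_⟩
  intro y hy hmin
  have hWo : IsOpen (Iic y)ᶜ := (hX.1.1.isClosed_Iic y).isOpen_compl
  have hWu : IsUpperSet (Iic y)ᶜ := (isLowerSet_Iic y).compl
  have hO : IsClopen (closure (Iic y)ᶜ)ᶜ :=
    IsClopen.compl ⟨isClosed_closure, hX.2 _ hWo hWu⟩
  have hsub : (closure (Iic y)ᶜ)ᶜ ⊆ Iic y := compl_subset_comm.1 subset_closure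
  have hne : (⋂ n, V n ∩ (closure (Iic y)ᶜ)ᶜ).Nonempty := by
    refine IsCompact.nonempty_iInter_of_sequence_nonempty_isCompact_isClosed _
      (fun n => inter_subset_inter_left _ ((hVs n).subset (hV n))) (fun n => ?_)
      ((hV 0).1.inter hO).isClosed.isCompact fun n => ((hV n).1.inter hO).isClosed
    by_contra h
    rw [← not_disjoint_iff_nonempty_inter, not_not, disjoint_compl_right_iff_subset] at h
    exact hVs n _ hWo hWu h (mem_iInter.1 hy (n + 1)) le_rfl
  obtain ⟨z, hz⟩ := hne
  rw [mem_iInter] at hz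
  have hzO := (hz 0).2
  obtain rfl : z = y := hmin z (mem_iInter.2 fun n => (hz n).1) (hsub hzO)
  suffices h : (closure (Iic z)ᶜ)ᶜ = Iic z by
    change IsClopen (Iic z)
    exact h ▸ hO
  refine hsub.antisymm fun w hw hwc => ?_
  obtain ⟨v, hvO, hv⟩ : ∃ v ∈ downClosure X (closure (Iic z)ᶜ)ᶜ, v ∈ (Iic z)ᶜ :=
    mem_closure_iff.1 hwc _ (hX.1.2 _ hO).isOpen ⟨z, hzO, hw⟩
  obtain ⟨u, hu, hvu⟩ := hvO
  exact hv (hvu.trans (hsub hu))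

/-- In a continuous L-space, `V ≪ U` is witnessed by a Scott upset between `V` and `ker U`. -/
theorem IsLSpace.exists_isScottUpset_between (hX : IsLSpace X)
    (hcont : ∀ U ∈ ClopUp X, U ⊆ closure (kerSet X U)) {V U : Set X}
    (hV : IsClosed V) (hU : U ∈ ClopUp X) (hVU : wayBelowSet X V U) :
    ∃ F, IsScottUpset X F ∧ V ⊆ F ∧ F ⊆ kerSet X U := by
  have := hX.1.1.1
  choose! next hnext using fun (U : Set X) (h : U ∈ ClopUp X ∧ wayBelowSet X V U) =>
    h.2.exists_between hcont hV h.1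
  let S : ℕ → Set X := fun n => next^[n] U
  have hsucc (n : ℕ) : S (n + 1) = next (S n) := Function.iterate_succ_apply' _ _ _
  have hS (n : ℕ) : S n ∈ ClopUp X ∧ wayBelowSet X V (S n) := by
    induction n with
    | zero => exact ⟨hU, hVU⟩
    | succ n ih =>
      rw [hsucc]
      exact ⟨(hnext _ ih).1, (hnext _ ih).2.2⟩
  have hSs (n : ℕ) : wayBelowSet X (S (n + 1)) (S n) := by
    rw [hsucc]
    exact (hnext _ (hS n)).2.1
  exact ⟨⋂ n, S n, hX.isScottUpset_iInter (fun n => (hS n).1) hSs,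
    subset_iInter fun n => (hS n).2.subset (hS n).1,
    (iInter_subset S 1).trans (subset_sUnion_of_mem ⟨(hS 1).1, hSs 0⟩)⟩

/-- A Scott upset is covered by a single clopen Scott upset inside `U` once each of its points in
the spatial part is. -/
theorem IsScottUpset.exists_mem_ClopSUp (hX : IsPriestley X) {F U : Set X}
    (hF : IsScottUpset X F)
    (h : ∀ y ∈ F ∩ spatialPart X, ∃ V ∈ ClopSUp X, y ∈ V ∧ V ⊆ U) :
    ∃ V ∈ ClopSUp X, F ⊆ V ∧ V ⊆ U := by
  have := hX.1
  refine hF.1.isCompact.induction_on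
    (p := fun K => ∃ V ∈ ClopSUp X, K ⊆ V ∧ V ⊆ U) ?_ ?_ ?_ ?_
  · exact ⟨∅, empty_mem_ClopSUp, Subset.rfl, empty_subset _⟩
  · rintro K K' hK ⟨V, hV, hKV, hVU⟩
    exact ⟨V, hV, hK.trans hKV, hVU⟩
  · rintro K K' ⟨V, hV, hKV, hVU⟩ ⟨V', hV', hKV', hVU'⟩
    exact ⟨V ∪ V', union_mem_ClopSUp hV hV', union_subset_union hKV hKV', union_subset hVU hVU'⟩
  · intro x hx
    obtain ⟨y, hy, hyx, hmin⟩ := hX.exists_minimal_le hF.1 hx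
    obtain ⟨V, hV, hyV, hVU⟩ := h y ⟨hy, hF.2.2 y hy hmin⟩
    exact ⟨V, mem_nhdsWithin_of_mem_nhds (hV.1.isOpen.mem_nhds (hV.2.2.1 hyx hyV)),
      V, hV, Subset.rfl, hVU⟩

end LSpace

/-- characterizations of `ker U = core U` in a continuous L-space. -/
theorem stmt3 {X : Type*} [TopologicalSpace X] [PartialOrder X]
    (hX : IsLSpace X) (hcont : ∀ U ∈ ClopUp X, U ⊆ closure (kerSet X U))
    (U : Set X) (hU : U ∈ ClopUp X) :
    [kerSet X U = coreSet X U,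
      U ⊆ closure (coreSet X U),
      ∀ y ∈ U ∩ spatialPart X, ∃ V ∈ ClopSUp X, y ∈ V ∧ V ⊆ U,
      ∀ F : Set X, IsScottUpset X F → F ⊆ kerSet X U →
        ∃ V ∈ ClopSUp X, F ⊆ V ∧ V ⊆ U].TFAE := by
  tfae_have 1 → 2 := fun h => h ▸ hcont U hU
  tfae_have 2 → 3 := by
    rintro h y ⟨hyU, hy⟩
    obtain ⟨V, ⟨hV, hVU⟩, hyV⟩ :=
      mem_of_mem_closure_of_mem_spatialPart (isUpperSet_coreSet U) hy (h hyU)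
    exact ⟨V, hV, hyV, hVU⟩
  tfae_have 3 → 4 := fun h F hF hFU =>
    hF.exists_mem_ClopSUp hX.1.1 fun y hy => h y ⟨kerSet_subset hU (hFU hy.1), hy.2⟩
  tfae_have 4 → 1 := by
    refine fun h => Subset.antisymm ?_ (coreSet_subset_kerSet hX.1.1 U)
    refine sUnion_subset fun V hV => ?_
    obtain ⟨F, hF, hVF, hFU⟩ := hX.exists_isScottUpset_between hcont hV.1.1.isClosed hU hV.2
    obtain ⟨V', hV', hFV', hVU'⟩ := h F hF hFU
    exact (hVF.trans hFV').trans (subset_sUnion_of_mem ⟨hV', hVU'⟩)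
  tfae_finish
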